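/- arXiv:0801.2888 — 2 statements merged into one kernel-verified Lean document; each statement's English description precedes it below -/
import Mathlib

section
/- Let N ≥ 1 and M > 0, and let f : ℝ^N → ℝ be measurable with 0 ≤ f ≤ 1 a.e., ∫_{ℝ^N} f(v) dv = M and ∫_{ℝ^N} |v|² f(v) dv < ∞. Then H(f) ≥ H(F_M), i.e. the Fermi-Dirac distribution F_M minimizes the free energy H among densities with values in [0,1], mass M and finite kinetic energy. -/
open MeasureTheory Real Filter
open scoped ENNReal NNReal Topology

noncomputable section

/-- ℝ^N as a Euclidean space. -/
abbrev Evec (N : ℕ) := EuclideanSpace ℝ (Fin N)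


/-- `s(r) = (1-r)log(1-r) + r log r` (with the convention `log 0 = 0`, so `s(0)=s(1)=0`). -/
noncomputable def entFn (r : ℝ) : ℝ := (1 - r) * Real.log (1 - r) + r * Real.log r

/-- The entropy `S(g) = ∫ s(g(v)) dv`. -/
noncomputable def Sent (N : ℕ) (g : Evec N → ℝ) : ℝ := ∫ v : Evec N, entFn (g v)

/-- The kinetic energy `E(g) = (1/2) ∫ |v|² g(v) dv`. -/
noncomputable def Ekin (N : ℕ) (g : Evec N → ℝ) : ℝ := (1 / 2) * ∫ v : Evec N, ‖v‖ ^ 2 * g v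

/-- The free energy `H(g) = S(g) + E(g)`. -/
noncomputable def Hfun (N : ℕ) (g : Evec N → ℝ) : ℝ := Sent N g + Ekin N g

/-- The Fermi-Dirac distribution `F^β(v) = (1 + β e^{|v|²/2})⁻¹`. -/
noncomputable def FD (N : ℕ) (β : ℝ) (v : Evec N) : ℝ := (1 + β * exp (‖v‖ ^ 2 / 2))⁻¹

/-- `β(M)`: the unique `β > 0` such that `F^β` has mass `M` (chosen via `Classical.epsilon`). -/
noncomputable def betaOf (N : ℕ) (M : ℝ) : ℝ :=
  Classical.epsilon (fun β : ℝ => 0 < β ∧ ∫ v : Evec N, FD N β v = M)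

/-- The Fermi-Dirac equilibrium `F_M = F^{β(M)}` of mass `M`. -/
noncomputable def FDM (N : ℕ) (M : ℝ) : Evec N → ℝ := FD N (betaOf N M)


lemma aux_gauss (N : ℕ) (b : ℝ) (hb : 0 < b) :
    Integrable (fun v : Evec N => Real.exp (-b * ‖v‖ ^ 2)) volume := by
  have h := (GaussianFourier.integrable_cexp_neg_mul_sq_norm_add (V := Evec N)
    (b := (b : ℂ)) (by simpa using hb) 0 0).norm
  refine h.congr (Eventually.of_forall fun v => ?_)
  simp only [Complex.norm_exp]
  congr 1
  simp [← Complex.ofReal_pow]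

lemma aux_klein (r p : ℝ) (hr : 0 ≤ r) (hp : 0 < p) :
    r * Real.log p + r - p ≤ r * Real.log r := by
  rcases hr.eq_or_lt with h | h
  · subst h; simp; exact hp.le
  · have h1 := Real.log_le_sub_one_of_pos (div_pos hp h)
    rw [Real.log_div hp.ne' h.ne'] at h1
    have h2 := mul_le_mul_of_nonneg_left h1 h.le
    have h3 : r * (p / r - 1) = p - r := by field_simp
    nlinarith

lemma aux_ent (r p : ℝ) (hr : 0 ≤ r) (hr1 : r ≤ 1) (hp : 0 < p) (hp1 : p < 1) :
    (1 - r) * Real.log (1 - p) + r * Real.log p ≤ entFn r := by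
  have h1 := aux_klein r p hr hp
  have h2 := aux_klein (1 - r) (1 - p) (by linarith) (by linarith)
  unfold entFn
  linarith

lemma aux_FD (N : ℕ) (β : ℝ) (hβ : 0 < β) (v : Evec N) :
    0 < FD N β v ∧ FD N β v < 1 ∧
    FD N β v ≤ β⁻¹ * Real.exp (-(1/2) * ‖v‖ ^ 2) ∧
    Real.log (FD N β v) = Real.log (1 - FD N β v) - (‖v‖ ^ 2 / 2 + Real.log β) ∧
    - (β⁻¹ * Real.exp (-(1/2) * ‖v‖ ^ 2)) ≤ Real.log (1 - FD N β v) := by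
  have he : 0 < β * Real.exp (‖v‖ ^ 2 / 2) := by positivity
  have hexp : β⁻¹ * Real.exp (-(1/2) * ‖v‖ ^ 2) = (β * Real.exp (‖v‖ ^ 2 / 2))⁻¹ := by
    rw [mul_inv, ← Real.exp_neg]; congr 2; ring
  have hlog : Real.log (β * Real.exp (‖v‖ ^ 2 / 2)) = ‖v‖ ^ 2 / 2 + Real.log β := by
    rw [Real.log_mul hβ.ne' (Real.exp_pos _).ne', Real.log_exp]; ring
  rw [hexp, ← hlog]
  unfold FD
  set y := β * Real.exp (‖v‖ ^ 2 / 2) with hy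
  have h1 : 1 - (1 + y)⁻¹ = y * (1 + y)⁻¹ := by field_simp; ring
  have h2 : (1 - (1 + y)⁻¹)⁻¹ = 1 + y⁻¹ := by rw [h1]; field_simp; ring
  refine ⟨by positivity, inv_lt_one_of_one_lt₀ (by linarith), ?_, ?_, ?_⟩
  · apply inv_anti₀ he; linarith
  · rw [h1, Real.log_mul he.ne' (by positivity)]; ring
  · have h3 : 0 < y⁻¹ := by positivity
    have h4 := Real.log_le_sub_one_of_pos (show 0 < 1 + y⁻¹ by linarith)
    rw [← h2, Real.log_inv, h2] at h4
    linarith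

lemma aux_FDcont (N : ℕ) (β : ℝ) (hβ : 0 < β) : Continuous (FD N β) := by
  unfold FD
  refine Continuous.inv₀ (by fun_prop) fun v => ?_
  positivity

lemma aux_FDint (N : ℕ) (β : ℝ) (hβ : 0 < β) : Integrable (FD N β) volume := by
  refine ((aux_gauss N (1/2) (by norm_num)).const_mul β⁻¹).mono'
    (aux_FDcont N β hβ).aestronglyMeasurable (Eventually.of_forall fun v => ?_)
  obtain ⟨h0, -, h2, -⟩ := aux_FD N β hβ v
  rw [Real.norm_of_nonneg h0.le]; exact h2

lemma aux_FDint2 (N : ℕ) (β : ℝ) (hβ : 0 < β) :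
    Integrable (fun v => ‖v‖ ^ 2 * FD N β v) volume := by
  refine ((aux_gauss N (1/4) (by norm_num)).const_mul (4 * β⁻¹)).mono'
    ((continuous_norm.pow 2).mul (aux_FDcont N β hβ)).aestronglyMeasurable
    (Eventually.of_forall fun v => ?_)
  obtain ⟨h0, -, h2, -⟩ := aux_FD N β hβ v
  rw [Real.norm_of_nonneg (by positivity)]
  have h3 : ‖v‖ ^ 2 * Real.exp (-(1/4) * ‖v‖ ^ 2) ≤ 4 := by
    have := Real.add_one_le_exp (1/4 * ‖v‖ ^ 2)
    have h5 : -(1/4) * ‖v‖ ^ 2 = -(1/4 * ‖v‖ ^ 2) := by ring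
    rw [h5, Real.exp_neg, ← div_eq_mul_inv, div_le_iff₀ (Real.exp_pos _)]
    linarith
  calc ‖v‖ ^ 2 * FD N β v ≤ ‖v‖ ^ 2 * (β⁻¹ * Real.exp (-(1/2) * ‖v‖ ^ 2)) := by gcongr
    _ = (‖v‖ ^ 2 * Real.exp (-(1/4) * ‖v‖ ^ 2)) * (β⁻¹ * Real.exp (-(1/4) * ‖v‖ ^ 2)) := by
      have : Real.exp (-(1/2) * ‖v‖ ^ 2) =
          Real.exp (-(1/4) * ‖v‖ ^ 2) * Real.exp (-(1/4) * ‖v‖ ^ 2) := by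
        rw [← Real.exp_add]; congr 1; ring
      rw [this]; ring
    _ ≤ 4 * (β⁻¹ * Real.exp (-(1/4) * ‖v‖ ^ 2)) := by gcongr
    _ = _ := by ring

lemma aux_entint (N : ℕ) (f : Evec N → ℝ) (hmeas : Measurable f)
    (hb : ∀ᵐ v : Evec N ∂volume, 0 ≤ f v ∧ f v ≤ 1)
    (hE : Integrable (fun v : Evec N => ‖v‖ ^ 2 * f v) volume) :
    Integrable (fun v => entFn (f v)) volume := by
  refine (((aux_gauss N (1/2) (by norm_num)).const_mul (1:ℝ)⁻¹).add (hE.const_mul (1/2))).mono'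
    ?_ ?_
  · apply Measurable.aestronglyMeasurable
    unfold entFn
    fun_prop
  · filter_upwards [hb] with v ⟨h0, h1⟩
    obtain ⟨p0, p1, -, h2, h3⟩ := aux_FD N 1 one_pos v
    have h4 := aux_ent (f v) _ h0 h1 p0 p1
    rw [h2, Real.log_one] at h4
    have h5 : entFn (f v) ≤ 0 := by
      unfold entFn
      have := mul_nonpos_of_nonneg_of_nonpos h0 (Real.log_nonpos h0 h1)
      have := mul_nonpos_of_nonneg_of_nonpos (sub_nonneg.2 h1)
        (Real.log_nonpos (sub_nonneg.2 h1) (by linarith))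
      linarith
    rw [Real.norm_of_nonpos h5]
    simp only [Pi.add_apply]
    linarith

lemma aux_exists (N : ℕ) (hN : 1 ≤ N) (M : ℝ) (hM : 0 < M) :
    ∃ β : ℝ, 0 < β ∧ ∫ v : Evec N, FD N β v = M := by
  have hc : ContinuousOn (fun β => ∫ v : Evec N, FD N β v) (Set.Ioi 0) := by
    intro β₀ hβ₀
    have hβ₀ : 0 < β₀ := hβ₀
    apply ContinuousAt.continuousWithinAt
    apply continuousAt_of_dominated
      (bound := fun v => (β₀ / 2)⁻¹ * Real.exp (-(1/2) * ‖v‖ ^ 2))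
    · filter_upwards [Ioi_mem_nhds hβ₀] with β hβ
      exact (aux_FDcont N β hβ).aestronglyMeasurable
    · filter_upwards [Ioi_mem_nhds (half_lt_self hβ₀)] with β hβ
      have hβ : β₀ / 2 < β := hβ
      refine Eventually.of_forall fun v => ?_
      obtain ⟨h0, -, h2, -⟩ := aux_FD N β (by linarith) v
      rw [Real.norm_of_nonneg h0.le]
      refine h2.trans ?_
      gcongr
    · exact (aux_gauss N (1/2) (by norm_num)).const_mul _
    · refine Eventually.of_forall fun v => ?_
      unfold FD
      refine ContinuousAt.inv₀ (by fun_prop) ?_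
      positivity
  -- upper
  set C := ∫ v : Evec N, Real.exp (-(1/2) * ‖v‖ ^ 2) with hC
  have hC0 : 0 ≤ C := integral_nonneg fun v => (Real.exp_pos _).le
  have hsmall : ∃ b : ℝ, 0 < b ∧ ∫ v : Evec N, FD N b v ≤ M := by
    have hb : 0 < (C + 1) / M := by positivity
    refine ⟨(C + 1) / M, hb, ?_⟩
    calc ∫ v : Evec N, FD N ((C + 1) / M) v
        ≤ ∫ v : Evec N, ((C + 1) / M)⁻¹ * Real.exp (-(1/2) * ‖v‖ ^ 2) :=
          integral_mono (aux_FDint N _ hb) ((aux_gauss N (1/2) (by norm_num)).const_mul _)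
            fun v => (aux_FD N _ hb v).2.2.1
      _ = ((C + 1) / M)⁻¹ * C := by rw [integral_const_mul]
      _ ≤ M := by
        rw [inv_div, div_mul_eq_mul_div, div_le_iff₀ (by linarith)]
        nlinarith
  have hlarge : ∃ a : ℝ, 0 < a ∧ M ≤ ∫ v : Evec N, FD N a v := by
    set m := (volume : Measure (Evec N)).real (Metric.closedBall 0 1) with hm
    have hm0 : 0 < m :=
      ENNReal.toReal_pos (Metric.measure_closedBall_pos _ _ one_pos).ne'
        measure_closedBall_lt_top.ne
    set R := 1 + 2 * M / m with hR
    have hR1 : 1 ≤ R := by rw [hR]; have : 0 < 2 * M / m := by positivity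
                           linarith
    have hvol : 2 * M ≤ (volume : Measure (Evec N)).real (Metric.closedBall 0 R) := by
      have h : (volume : Measure (Evec N)).real (Metric.closedBall 0 R) = R ^ N * m := by
        rw [hm, Measure.real, Measure.addHaar_closedBall' _ _ (by linarith), ENNReal.toReal_mul,
          ENNReal.toReal_ofReal (by positivity)]
        simp [Measure.real]
      rw [h]
      have h1 : R ≤ R ^ N := le_self_pow₀ hR1 (by omega)
      have h2 : R * m = m + 2 * M := by rw [hR]; field_simp
      nlinarith
    refine ⟨Real.exp (-(R ^ 2 / 2)), Real.exp_pos _, ?_⟩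
    calc M ≤ (volume : Measure (Evec N)).real (Metric.closedBall 0 R) * (1/2) := by linarith
      _ = ∫ v in Metric.closedBall (0 : Evec N) R, (1/2 : ℝ) := by simp
      _ ≤ ∫ v in Metric.closedBall (0 : Evec N) R, FD N (Real.exp (-(R ^ 2 / 2))) v := by
        refine setIntegral_mono_on (integrableOn_const measure_closedBall_lt_top.ne)
          (aux_FDint N _ (Real.exp_pos _)).integrableOn measurableSet_closedBall fun v hv => ?_
        have hv : ‖v‖ ≤ R := by simpa using hv
        unfold FD
        rw [one_div]
        refine inv_anti₀ (by positivity) ?_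
        rw [← Real.exp_add]
        have : Real.exp (-(R ^ 2 / 2) + ‖v‖ ^ 2 / 2) ≤ 1 := by
          rw [Real.exp_le_one_iff]
          have : ‖v‖ ^ 2 ≤ R ^ 2 := by gcongr
          linarith
        linarith
      _ ≤ _ := setIntegral_le_integral (aux_FDint N _ (Real.exp_pos _))
          (Eventually.of_forall fun v => (aux_FD N _ (Real.exp_pos _) v).1.le)
  obtain ⟨b, hb, hbM⟩ := hsmall
  obtain ⟨a, ha, haM⟩ := hlarge
  obtain ⟨β, hβ, h⟩ := isPreconnected_Ioi.intermediate_value (s := Set.Ioi (0:ℝ)) hb ha hc ⟨hbM, haM⟩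
  exact ⟨β, hβ, h⟩

/-- **`F_M` minimizes the free energy.** Among measurable densities with values in `[0,1]`,
mass `M > 0` and finite kinetic energy, the Fermi-Dirac distribution `F_M` minimizes
`H = S + E`. -/
theorem FDM_minimizes_free_energy
    (N : ℕ) (hN : 1 ≤ N) (M : ℝ) (hM : 0 < M)
    (f : Evec N → ℝ) (hmeas : Measurable f)
    (hb : ∀ᵐ v : Evec N ∂volume, 0 ≤ f v ∧ f v ≤ 1)
    (hmass : ∫ v : Evec N, f v = M)
    (hE : Integrable (fun v : Evec N => ‖v‖ ^ 2 * f v) volume) :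
    Hfun N (FDM N M) ≤ Hfun N f := by
  obtain ⟨hβ, hβM⟩ : 0 < betaOf N M ∧ ∫ v : Evec N, FD N (betaOf N M) v = M :=
    Classical.epsilon_spec (p := fun β : ℝ => 0 < β ∧ ∫ v : Evec N, FD N β v = M)
      (aux_exists N hN M hM)
  unfold FDM
  set β := betaOf N M
  have hf : Integrable f volume := by
    by_contra h
    rw [integral_undef h] at hmass
    linarith
  have hF := aux_FDint N β hβ
  have hF2 := aux_FDint2 N β hβ
  have hFs := aux_entint N (FD N β) (aux_FDcont N β hβ).measurable
    (Eventually.of_forall fun v => ⟨(aux_FD N β hβ v).1.le, (aux_FD N β hβ v).2.1.le⟩) hF2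
  have hfs := aux_entint N f hmeas hb hE
  have key : ∀ g : Evec N → ℝ, Integrable g volume →
      Integrable (fun v => ‖v‖ ^ 2 * g v) volume → Integrable (fun v => entFn (g v)) volume →
      ∫ v, g v = M →
      ∫ v, ((entFn (g v) + (1 / 2) * (‖v‖ ^ 2 * g v)) + Real.log β * g v)
        = Hfun N g + Real.log β * M := by
    intro g h1 h2 h3 h4
    have h5 : Integrable (fun v => entFn (g v) + (1 / 2) * (‖v‖ ^ 2 * g v)) volume :=
      h3.add (h2.const_mul _)
    rw [integral_add h5 (h1.const_mul _),
      integral_add h3 (h2.const_mul _), integral_const_mul, integral_const_mul, h4]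
    rfl
  have k1 := key _ hF hF2 hFs hβM
  have k2 := key _ hf hE hfs hmass
  have : Hfun N (FD N β) + Real.log β * M ≤ Hfun N f + Real.log β * M := by
    rw [← k1, ← k2]
    refine integral_mono_ae ((hFs.add (hF2.const_mul _)).add (hF.const_mul _))
      ((hfs.add (hE.const_mul _)).add (hf.const_mul _)) ?_
    filter_upwards [hb] with v ⟨h0, h1⟩
    obtain ⟨p0, p1, -, h2, -⟩ := aux_FD N β hβ v
    have h4 := aux_ent (f v) _ h0 h1 p0 p1
    have h5 : entFn (FD N β v) = (1 - FD N β v) * Real.log (1 - FD N β v)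
      + FD N β v * Real.log (FD N β v) := rfl
    rw [h5]
    rw [h2] at h4 ⊢
    linarith
  linarith
end
end

section
/- Let N ≥ 1. For every M > 0 there exists a unique β > 0 such that the Fermi-Dirac distribution F^β has mass M, that is, ∫_{ℝ^N} (1 + β e^{|v|²/2})^{−1} dv = M. -/
open MeasureTheory Real Filter
open scoped ENNReal NNReal Topology

noncomputable section

lemma gauss_integrable (N : ℕ) : Integrable (fun v : Evec N => exp (-(1/2) * ‖v‖ ^ 2)) := by
  by_contra h
  have h1 := integral_undef h
  have h2 := GaussianFourier.integral_rexp_neg_mul_sq_norm (V := Evec N) (b := 1/2) (by norm_num)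
  rw [h1] at h2
  have : (0:ℝ) < (π / (1/2)) ^ (Module.finrank ℝ (Evec N) / 2 : ℝ) := by positivity
  linarith

lemma FD_pos (N : ℕ) {β : ℝ} (hβ : 0 < β) (v : Evec N) : 0 < FD N β v := by
  unfold FD; positivity

lemma FD_le (N : ℕ) {a β : ℝ} (ha : 0 < a) (hβ : a ≤ β) (v : Evec N) :
    FD N β v ≤ a⁻¹ * exp (-(1/2) * ‖v‖ ^ 2) := by
  have e : exp (-(1/2) * ‖v‖ ^ 2) = (exp (‖v‖ ^ 2 / 2))⁻¹ := by
    rw [← Real.exp_neg]; congr 1; ring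
  rw [e, ← mul_inv]
  unfold FD
  have := exp_pos (‖v‖ ^ 2 / 2)
  apply inv_anti₀ (by positivity)
  nlinarith

lemma FD_cont (N : ℕ) {β : ℝ} (hβ : 0 < β) : Continuous (FD N β) := by
  unfold FD
  apply Continuous.inv₀ (by fun_prop)
  intro v; positivity

lemma FD_int (N : ℕ) {β : ℝ} (hβ : 0 < β) : Integrable (FD N β) := by
  refine ((gauss_integrable N).const_mul β⁻¹).mono' (FD_cont N hβ).aestronglyMeasurable ?_
  refine Eventually.of_forall fun v => ?_
  rw [Real.norm_of_nonneg (FD_pos N hβ v).le]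
  exact FD_le N hβ le_rfl v

lemma FD_lt (N : ℕ) {a b : ℝ} (ha : 0 < a) (hab : a < b) :
    ∫ v : Evec N, FD N b v < ∫ v : Evec N, FD N a v := by
  have hb := ha.trans hab
  have hp : ∀ v, 0 < FD N a v - FD N b v := by
    intro v
    rw [sub_pos]
    unfold FD
    have := exp_pos (‖v‖ ^ 2 / 2)
    apply inv_strictAnti₀ (by positivity)
    nlinarith
  rw [← sub_pos, ← integral_sub (FD_int N ha) (FD_int N hb)]
  rw [integral_pos_iff_support_of_nonneg (fun v => (hp v).le) ((FD_int N ha).sub (FD_int N hb))]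
  have : Function.support (fun v => FD N a v - FD N b v) = Set.univ := by
    ext v; simpa using (hp v).ne'
  rw [this]
  exact isOpen_univ.measure_pos _ Set.univ_nonempty

lemma FD_contOn (N : ℕ) {a : ℝ} (ha : 0 < a) :
    ContinuousOn (fun β => ∫ v : Evec N, FD N β v) (Set.Ici a) := by
  refine continuousOn_of_dominated (bound := fun v => a⁻¹ * exp (-(1/2) * ‖v‖ ^ 2)) ?_ ?_ ?_ ?_
  · intro β hβ
    exact (FD_cont N (ha.trans_le hβ)).aestronglyMeasurable
  · intro β hβ
    refine Eventually.of_forall fun v => ?_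
    rw [Real.norm_of_nonneg (FD_pos N (ha.trans_le hβ) v).le]
    exact FD_le N ha hβ v
  · exact (gauss_integrable N).const_mul _
  · refine Eventually.of_forall fun v => ?_
    unfold FD
    refine ContinuousOn.inv₀ (by fun_prop) ?_
    intro β hβ
    have : 0 < β := ha.trans_le hβ
    positivity

lemma FD_large (N : ℕ) (hN : 1 ≤ N) (M : ℝ) (hM : 0 < M) :
    ∃ a : ℝ, 0 < a ∧ M ≤ ∫ v : Evec N, FD N a v := by
  set c := (volume (Metric.ball (0 : Evec N) 1)).toReal with hc
  have hcpos : 0 < c := ENNReal.toReal_pos (Metric.measure_ball_pos _ _ one_pos).ne'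
    measure_ball_lt_top.ne
  set R := max 1 (2 * M / c) with hR
  have hR1 : 1 ≤ R := le_max_left _ _
  have hR2 : 2 * M / c ≤ R := le_max_right _ _
  have hv : (volume (Metric.ball (0 : Evec N) R)).toReal = R ^ N * c := by
    rw [Measure.addHaar_ball_of_pos _ _ (by linarith), ENNReal.toReal_mul,
      ENNReal.toReal_ofReal (pow_nonneg (zero_le_one.trans hR1) _), finrank_euclideanSpace_fin]
  have hRN : R ≤ R ^ N := le_self_pow₀ hR1 (by omega)
  have hbig : 2 * M ≤ R ^ N * c := by
    rw [div_le_iff₀ hcpos] at hR2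
    nlinarith
  have ha : 0 < exp (-(R ^ 2 / 2)) := exp_pos _
  refine ⟨exp (-(R ^ 2 / 2)), ha, ?_⟩
  calc M ≤ ∫ v in Metric.ball (0 : Evec N) R, (1/2 : ℝ) := by
        rw [setIntegral_const, measureReal_def, hv, smul_eq_mul]; linarith
    _ ≤ ∫ v in Metric.ball (0 : Evec N) R, FD N (exp (-(R ^ 2 / 2))) v := by
        refine setIntegral_mono_on (integrableOn_const measure_ball_lt_top.ne)
          (FD_int N ha).integrableOn measurableSet_ball ?_
        intro v hv
        rw [mem_ball_zero_iff] at hv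
        unfold FD
        rw [← Real.exp_add, one_div]
        apply inv_anti₀ (by positivity)
        have : exp (-(R ^ 2 / 2) + ‖v‖ ^ 2 / 2) ≤ 1 := by
          rw [Real.exp_le_one_iff]
          nlinarith [norm_nonneg v]
        linarith
    _ ≤ _ := setIntegral_le_integral (FD_int N ha)
        (Eventually.of_forall fun v => (FD_pos N ha v).le)

lemma FD_small (N : ℕ) (M : ℝ) (hM : 0 < M) (a : ℝ) :
    ∃ b : ℝ, a ≤ b ∧ 0 < b ∧ ∫ v : Evec N, FD N b v ≤ M := by
  set G := ∫ v : Evec N, exp (-(1/2) * ‖v‖ ^ 2) with hG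
  have hb : 0 < max (max a 1) (G / M) := lt_max_of_lt_left (lt_max_of_lt_right one_pos)
  have h2 : G / M ≤ max (max a 1) (G / M) := le_max_right _ _
  refine ⟨max (max a 1) (G / M), (le_max_left _ _).trans (le_max_left _ _), hb, ?_⟩
  generalize max (max a 1) (G / M) = b at *
  have h := integral_mono (FD_int N hb) ((gauss_integrable N).const_mul b⁻¹) (FD_le N hb le_rfl)
  rw [integral_const_mul, ← hG] at h
  refine h.trans ?_
  rw [inv_mul_le_iff₀ hb]
  rwa [div_le_iff₀ hM] at h2

/-- **Existence and uniqueness of the Fermi-Dirac equilibrium of given mass.** For every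
`M > 0` there is a unique `β > 0` such that `∫ (1 + β e^{|v|²/2})⁻¹ dv = M`. -/
theorem exists_unique_fermi_dirac_beta
    (N : ℕ) (hN : 1 ≤ N) (M : ℝ) (hM : 0 < M) :
    ∃! β : ℝ, 0 < β ∧ ∫ v : Evec N, FD N β v = M := by
  obtain ⟨a, ha, haM⟩ := FD_large N hN M hM
  obtain ⟨b, hab, hb, hbM⟩ := FD_small N M hM a
  obtain ⟨β, hβ, h⟩ := intermediate_value_Icc' hab
    ((FD_contOn N ha).mono Set.Icc_subset_Ici_self) ⟨hbM, haM⟩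
  refine ⟨β, ⟨ha.trans_le hβ.1, h⟩, ?_⟩
  rintro γ ⟨hγ, hγM⟩
  have hβ0 : 0 < β := ha.trans_le hβ.1
  simp only at h
  rcases lt_trichotomy γ β with h1 | h1 | h1
  · have := FD_lt N hγ h1
    linarith
  · exact h1
  · have := FD_lt N hβ0 h1
    linarith
end
end
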